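/- Assume g satisfies conditions (2.4) and let N ≥ 2. For each α > 0 and each s ≥ 0, let ψ_α(s) denote the unique number ψ ≥ α satisfying g(s²)s = (1 − α^N ψ^{−N}) ψ. If q₀ > 0 and c₁ > 0 satisfy the inequalities (1/N)∫₀^{q₀} s G(s²) ds < c₁ < ∫₀^{q₀} s G(s²) ds, then there exists a unique α > 0 such that ∫₀^{q₀} s ψ_α'(s) ds = c₁. -/

import Mathlib

open Set Filter

noncomputable section

/-- `G(ξ) = g(ξ) + 2ξ g'(ξ)`, from (1.2). -/
def Gfun (g : ℝ → ℝ) (ξ : ℝ) : ℝ := g ξ + 2 * ξ * deriv g ξ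

/-- Conditions (2.4) on `g`. -/
def Cond24 (g : ℝ → ℝ) : Prop :=
  ContDiffOn ℝ (⊤ : ℕ∞) g (Ioi 0) ∧ (∀ ξ > (0:ℝ), 0 < g ξ) ∧
  Tendsto (fun ξ : ℝ => g (ξ ^ 2) * ξ) (nhdsWithin 0 (Ioi 0)) (nhds 0) ∧
  Tendsto (fun ξ : ℝ => g (ξ ^ 2) * ξ) atTop atTop ∧
  (∀ ξ > (0:ℝ), 0 < Gfun g ξ)

/-- The function `ψ ↦ ψ - ψ^{1-N}` in the logarithmic variable `t = log ψ`. -/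
def expDiff (N : ℕ) (t : ℝ) : ℝ := Real.exp t - Real.exp (-((N - 1 : ℝ) * t))

lemma expDiff_hasDerivAt (N : ℕ) (t : ℝ) :
    HasDerivAt (expDiff N)
      (Real.exp t + (N - 1 : ℝ) * Real.exp (-((N - 1 : ℝ) * t))) t := by
  have h1 : HasDerivAt (fun t : ℝ => -((N - 1 : ℝ) * t)) (-((N - 1 : ℝ) * 1)) t :=
    ((hasDerivAt_id t).const_mul _).neg
  refine ((Real.hasDerivAt_exp t).sub h1.exp).congr_deriv ?_
  ring

lemma expDiff_continuous (N : ℕ) : Continuous (expDiff N) := by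
  unfold expDiff
  fun_prop

lemma expDiff_strictMono {N : ℕ} (hN : 2 ≤ N) : StrictMono (expDiff N) := by
  have hN' : (2 : ℝ) ≤ N := by exact_mod_cast hN
  intro a b hab
  unfold expDiff
  have h1 := Real.exp_lt_exp.2 hab
  have h2 : Real.exp (-((N - 1 : ℝ) * b)) < Real.exp (-((N - 1 : ℝ) * a)) :=
    Real.exp_lt_exp.2 (by nlinarith)
  linarith

lemma expDiff_surjective {N : ℕ} (hN : 2 ≤ N) : Function.Surjective (expDiff N) := by
  have hN' : (2 : ℝ) ≤ N := by exact_mod_cast hN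
  refine (expDiff_continuous N).surjective ?_ ?_
  · refine tendsto_atTop_mono' atTop (f₁ := fun t => t) ?_ tendsto_id
    filter_upwards [eventually_ge_atTop 0] with t ht
    have h1 := Real.add_one_le_exp t
    have h2 : Real.exp (-((N - 1 : ℝ) * t)) ≤ 1 := Real.exp_le_one_iff.2 (by nlinarith)
    unfold expDiff
    linarith
  · refine tendsto_atBot_mono' (f₁ := fun t : ℝ => t) atBot ?_ tendsto_id
    filter_upwards [eventually_le_atBot 0] with t ht
    have h1 : Real.exp t ≤ 1 := Real.exp_le_one_iff.2 ht
    have h2 := Real.add_one_le_exp (-((N - 1 : ℝ) * t))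
    unfold expDiff
    nlinarith

/-- The increasing bijection of `ℝ` given by `expDiff`. -/
def expDiffIso {N : ℕ} (hN : 2 ≤ N) : ℝ ≃o ℝ :=
  StrictMono.orderIsoOfSurjective (expDiff N) (expDiff_strictMono hN) (expDiff_surjective hN)

lemma expDiffIso_apply {N : ℕ} (hN : 2 ≤ N) (t : ℝ) : expDiffIso hN t = expDiff N t := rfl

lemma expDiffIso_symm_zero {N : ℕ} (hN : 2 ≤ N) : (expDiffIso hN).symm 0 = 0 := by
  rw [OrderIso.symm_apply_eq, expDiffIso_apply]
  simp [expDiff]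

/-- The ratio between the slope of `ψ_α` and that of `s ↦ g(s²)s`, as a function of
`g(s²)s / α`. -/
def slopeRatio {N : ℕ} (hN : 2 ≤ N) (y : ℝ) : ℝ :=
  (1 + (N - 1 : ℝ) * Real.exp (-(N * (expDiffIso hN).symm y)))⁻¹

section slopeRatio

variable {N : ℕ} (hN : 2 ≤ N)

lemma slopeRatio_denom_pos (y : ℝ) :
    1 < 1 + (N - 1 : ℝ) * Real.exp (-(N * (expDiffIso hN).symm y)) := by
  have hN' : (2 : ℝ) ≤ N := by exact_mod_cast hN
  have := mul_pos (by linarith : (0 : ℝ) < N - 1)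
    (Real.exp_pos (-(N * (expDiffIso hN).symm y)))
  linarith

lemma slopeRatio_pos (y : ℝ) : 0 < slopeRatio hN y :=
  inv_pos.2 (zero_lt_one.trans (slopeRatio_denom_pos hN y))

lemma slopeRatio_le_one (y : ℝ) : slopeRatio hN y ≤ 1 :=
  inv_le_one_of_one_le₀ (slopeRatio_denom_pos hN y).le

lemma slopeRatio_continuous : Continuous (slopeRatio hN) := by
  have hT : Continuous (expDiffIso hN).symm := (expDiffIso hN).symm.continuous
  refine Continuous.inv₀ (by fun_prop) fun y => ?_
  exact (zero_lt_one.trans (slopeRatio_denom_pos hN y)).ne'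

lemma slopeRatio_strictMono : StrictMono (slopeRatio hN) := by
  have hN' : (2 : ℝ) ≤ N := by exact_mod_cast hN
  intro a b hab
  refine inv_strictAnti₀ (zero_lt_one.trans (slopeRatio_denom_pos hN b)) ?_
  have hT := (expDiffIso hN).symm.strictMono hab
  have : Real.exp (-(N * (expDiffIso hN).symm b)) < Real.exp (-(N * (expDiffIso hN).symm a)) :=
    Real.exp_lt_exp.2 (by nlinarith)
  nlinarith

lemma slopeRatio_zero : slopeRatio hN 0 = 1 / N := by
  simp [slopeRatio, expDiffIso_symm_zero]

lemma slopeRatio_tendsto : Tendsto (slopeRatio hN) atTop (nhds 1) := by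
  have hN' : (0 : ℝ) < N := by exact_mod_cast (by omega : 0 < N)
  have h1 : Tendsto (fun y => Real.exp (-(N * (expDiffIso hN).symm y))) atTop (nhds 0) :=
    Real.tendsto_exp_neg_atTop_nhds_zero.comp
      ((expDiffIso hN).symm.tendsto_atTop.const_mul_atTop hN')
  have h2 : Tendsto (slopeRatio hN) atTop (nhds (1 + (N - 1 : ℝ) * 0)⁻¹) :=
    ((h1.const_mul (N - 1 : ℝ)).const_add 1).inv₀ (by simp)
  simpa using h2

/-- The derivative of the solution `α e^{t}` of `expDiff N t = f / α`. -/
lemma hasDerivAt_exp_expDiffIso_symm {f : ℝ → ℝ} {f' α s : ℝ} (hα : 0 < α)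
    (hf : HasDerivAt f f' s) :
    HasDerivAt (fun x => α * Real.exp ((expDiffIso hN).symm (α⁻¹ * f x)))
      (f' * slopeRatio hN (α⁻¹ * f s)) s := by
  have hN' : (2 : ℝ) ≤ N := by exact_mod_cast hN
  set t := (expDiffIso hN).symm (α⁻¹ * f s) with ht
  have hpos : 0 < Real.exp t + (N - 1 : ℝ) * Real.exp (-((N - 1 : ℝ) * t)) :=
    add_pos (Real.exp_pos _) (mul_pos (by linarith) (Real.exp_pos _))
  have hT : HasDerivAt (expDiffIso hN).symm
      (Real.exp t + (N - 1 : ℝ) * Real.exp (-((N - 1 : ℝ) * t)))⁻¹ (α⁻¹ * f s) :=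
    HasDerivAt.of_local_left_inverse (f := expDiff N)
      (expDiffIso hN).symm.continuous.continuousAt (expDiff_hasDerivAt N t) hpos.ne'
      (Eventually.of_forall fun y => (expDiffIso hN).apply_symm_apply y)
  have h := ((hT.comp s (hf.const_mul α⁻¹)).exp).const_mul α
  refine h.congr_deriv ?_
  simp only [Function.comp_apply, slopeRatio, ← ht]
  have hexp : Real.exp (-((N - 1 : ℝ) * t)) = Real.exp t * Real.exp (-(N * t)) := by
    rw [← Real.exp_add]
    ring_nf
  have hden : 0 < 1 + (N - 1 : ℝ) * Real.exp (-(N * t)) :=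
    zero_lt_one.trans (slopeRatio_denom_pos hN (α⁻¹ * f s))
  have hden' : Real.exp t + (N - 1 : ℝ) * (Real.exp t * Real.exp (-(N * t))) =
      Real.exp t * (1 + (N - 1 : ℝ) * Real.exp (-(N * t))) := by ring
  rw [hexp, hden']
  have he := (Real.exp_pos t).ne'
  have hd := hden.ne'
  field_simp

/-- The solution `ψ ≥ α` of the defining equation in terms of the inverse of `expDiff`. -/
lemma eq_mul_exp_of_solution {α ψ y : ℝ} (hα : 0 < α) (hψ : α ≤ ψ)
    (h : y = (1 - α ^ N * ψ ^ (-(N : ℤ))) * ψ) :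
    ψ = α * Real.exp ((expDiffIso hN).symm (α⁻¹ * y)) := by
  have hψ0 : 0 < ψ := hα.trans_le hψ
  have hr : 0 < ψ / α := div_pos hψ0 hα
  have hexp : Real.exp (-((N - 1 : ℝ) * Real.log (ψ / α))) = (ψ / α) * ((ψ / α) ^ N)⁻¹ := by
    have : -((N - 1 : ℝ) * Real.log (ψ / α)) = Real.log (ψ / α) + -(N * Real.log (ψ / α)) := by
      ring
    rw [this, Real.exp_add, Real.exp_neg, Real.exp_nat_mul, Real.exp_log hr]
  have key : expDiffIso hN (Real.log (ψ / α)) = α⁻¹ * y := by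
    rw [expDiffIso_apply, expDiff, hexp, Real.exp_log hr, h, zpow_neg, zpow_natCast, div_pow]
    field_simp
  rw [← key, OrderIso.symm_apply_apply, Real.exp_log hr]
  field_simp

end slopeRatio

/-- If `k` is continuous, bounded and increasing, then `β ↦ ∫ w(s) k(β f(s)) ds` takes each value
strictly between its value at `0` and its limit at `∞` exactly once on `(0, ∞)`. -/
lemma existsUnique_integral_mul_comp_eq {w f k : ℝ → ℝ} {q c : ℝ} (hq : 0 < q)
    (hw : IntervalIntegrable w MeasureTheory.volume 0 q) (hw0 : ∀ s > 0, 0 < w s)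
    (hf : ContinuousOn f (Ioi 0)) (hf0 : ∀ s > 0, 0 < f s)
    (hk : Continuous k) (hk0 : ∀ y, 0 < k y) (hk1 : ∀ y, k y ≤ 1) (hkm : StrictMono k)
    (hkt : Tendsto k atTop (nhds 1))
    (hlo : k 0 * (∫ s in (0:ℝ)..q, w s) < c) (hhi : c < ∫ s in (0:ℝ)..q, w s) :
    ∃! β : ℝ, 0 < β ∧ (∫ s in (0:ℝ)..q, w s * k (β * f s)) = c := by
  have hmeas : ∀ β : ℝ, MeasureTheory.AEStronglyMeasurable (fun s => w s * k (β * f s))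
      (MeasureTheory.volume.restrict (uIoc 0 q)) := by
    intro β
    refine hw.aestronglyMeasurable_restrict_uIoc.mul ?_
    refine ContinuousOn.aestronglyMeasurable ?_ measurableSet_uIoc
    rw [uIoc_of_le hq.le]
    exact hk.comp_continuousOn (continuousOn_const.mul (hf.mono fun s hs => hs.1))
  have hbound : ∀ β s : ℝ, ‖w s * k (β * f s)‖ ≤ ‖w s‖ := by
    intro β s
    rw [norm_mul, Real.norm_of_nonneg (hk0 _).le]
    exact mul_le_of_le_one_right (norm_nonneg _) (hk1 _)
  have hint : ∀ β : ℝ,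
      IntervalIntegrable (fun s => w s * k (β * f s)) MeasureTheory.volume 0 q := fun β =>
    hw.mono_fun (hmeas β) (Eventually.of_forall fun s => hbound β s)
  have hcont : Continuous fun β : ℝ => ∫ s in (0:ℝ)..q, w s * k (β * f s) := by
    refine intervalIntegral.continuous_of_dominated_interval (bound := fun s => ‖w s‖)
      hmeas (fun β => Eventually.of_forall fun s _ => hbound β s) hw.norm ?_
    refine Eventually.of_forall fun s _ => ?_
    fun_prop
  have hlim : Tendsto (fun β : ℝ => ∫ s in (0:ℝ)..q, w s * k (β * f s)) atTop
      (nhds (∫ s in (0:ℝ)..q, w s)) := by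
    refine intervalIntegral.tendsto_integral_filter_of_dominated_convergence (fun s => ‖w s‖)
      (Eventually.of_forall hmeas)
      (Eventually.of_forall fun β => Eventually.of_forall fun s _ => hbound β s) hw.norm ?_
    refine Eventually.of_forall fun s hs => ?_
    rw [uIoc_of_le hq.le] at hs
    simpa using (hkt.comp (tendsto_id.atTop_mul_const (hf0 s hs.1))).const_mul (w s)
  have hmono : StrictMono fun β : ℝ => ∫ s in (0:ℝ)..q, w s * k (β * f s) := by
    intro a b hab
    have h := intervalIntegral.intervalIntegral_pos_of_pos_on ((hint b).sub (hint a))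
      (fun s hs => sub_pos.2 (mul_lt_mul_of_pos_left
        (hkm (mul_lt_mul_of_pos_right hab (hf0 s hs.1))) (hw0 s hs.1))) hq
    rw [intervalIntegral.integral_sub (hint b) (hint a)] at h
    exact sub_pos.1 h
  have hzero : (∫ s in (0:ℝ)..q, w s * k (0 * f s)) < c := by
    simpa [intervalIntegral.integral_mul_const, mul_comm] using hlo
  obtain ⟨b, hb, hb0⟩ := ((hlim.eventually_const_lt hhi).and (eventually_ge_atTop 0)).exists
  obtain ⟨β, hβ, hβc⟩ := intermediate_value_Ioo hb0 hcont.continuousOn ⟨hzero, hb⟩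
  exact ⟨β, ⟨hβ.1, hβc⟩, fun γ hγ => hmono.injective (hγ.2.trans hβc.symm)⟩

lemma Cond24.hasDerivAt {g : ℝ → ℝ} (hg : Cond24 g) {s : ℝ} (hs : 0 < s) :
    HasDerivAt (fun s => g (s ^ 2) * s) (Gfun g (s ^ 2)) s := by
  have hs2 : 0 < s ^ 2 := by positivity
  have hd : HasDerivAt g (deriv g (s ^ 2)) (s ^ 2) :=
    ((hg.1.contDiffAt (Ioi_mem_nhds hs2)).differentiableAt (by simp)).hasDerivAt
  have hc : HasDerivAt (fun s => g (s ^ 2)) (deriv g (s ^ 2) * (2 * s)) s := by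
    have hp : HasDerivAt (fun s : ℝ => s ^ 2) (2 * s) s := by simpa using hasDerivAt_pow 2 s
    exact hd.comp s (h := fun s => s ^ 2) hp
  refine (hc.mul (hasDerivAt_id s)).congr_deriv ?_
  simp only [Gfun, id]
  ring

/-- Unique solvability of equation (3.20) in the proof of the paper's Theorem 3.1:
with `ψ_α(s)` (here `Ψ α s`) the unique `ψ ≥ α` satisfying `g(s²)s = (1 − αᴺ ψ^{−N}) ψ`,
if `q₀, c₁ > 0` satisfy the inequalities (3.5), then there is a unique `α > 0` with
`∫₀^{q₀} s ψ_α'(s) ds = c₁`. -/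
theorem stmt15 (N : ℕ) (hN : 2 ≤ N) (g : ℝ → ℝ) (hg : Cond24 g)
    (Ψ : ℝ → ℝ → ℝ)
    (hΨ : ∀ α > (0:ℝ), ∀ s ≥ (0:ℝ), α ≤ Ψ α s ∧
      g (s ^ 2) * s = (1 - α ^ N * (Ψ α s) ^ (-(N : ℤ))) * Ψ α s)
    (q₀ c₁ : ℝ) (hq₀ : 0 < q₀) (hc₁ : 0 < c₁)
    (hlo : (1 / N : ℝ) * (∫ s in (0:ℝ)..q₀, s * Gfun g (s ^ 2)) < c₁)
    (hhi : c₁ < ∫ s in (0:ℝ)..q₀, s * Gfun g (s ^ 2)) :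
    ∃! α : ℝ, 0 < α ∧ (∫ s in (0:ℝ)..q₀, s * deriv (Ψ α) s) = c₁ := by
  have hpos : 0 < ∫ s in (0:ℝ)..q₀, s * Gfun g (s ^ 2) := hc₁.trans hhi
  have hw : IntervalIntegrable (fun s => s * Gfun g (s ^ 2)) MeasureTheory.volume 0 q₀ := by
    by_contra h
    exact hpos.ne' (intervalIntegral.integral_undef h)
  have hderiv : ∀ α > 0, ∀ s > 0, deriv (Ψ α) s =
      Gfun g (s ^ 2) * slopeRatio hN (α⁻¹ * (g (s ^ 2) * s)) := by
    intro α hα s hs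
    refine ((hasDerivAt_exp_expDiffIso_symm hN hα (hg.hasDerivAt hs)).congr_of_eventuallyEq
      ?_).deriv
    filter_upwards [Ioi_mem_nhds hs] with x hx
    obtain ⟨h1, h2⟩ := hΨ α hα x (le_of_lt hx)
    exact eq_mul_exp_of_solution hN hα h1 h2
  have hint : ∀ α > 0, (∫ s in (0:ℝ)..q₀, s * deriv (Ψ α) s) =
      ∫ s in (0:ℝ)..q₀, s * Gfun g (s ^ 2) * slopeRatio hN (α⁻¹ * (g (s ^ 2) * s)) := by
    intro α hα
    refine intervalIntegral.integral_congr fun s hs => ?_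
    rw [uIcc_of_le hq₀.le] at hs
    rcases hs.1.eq_or_lt with rfl | h
    · simp
    · simp only [hderiv α hα s h, mul_assoc]
  obtain ⟨β, ⟨hβ, hβc⟩, huniq⟩ := existsUnique_integral_mul_comp_eq
    (w := fun s => s * Gfun g (s ^ 2)) (f := fun s => g (s ^ 2) * s) (k := slopeRatio hN) hq₀ hw
    (fun s hs => mul_pos hs (hg.2.2.2.2 _ (pow_pos hs 2)))
    (fun s hs => (hg.hasDerivAt hs).continuousAt.continuousWithinAt)
    (fun s hs => mul_pos (hg.2.1 _ (pow_pos hs 2)) hs)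
    (slopeRatio_continuous hN) (slopeRatio_pos hN) (slopeRatio_le_one hN)
    (slopeRatio_strictMono hN) (slopeRatio_tendsto hN) (by rwa [slopeRatio_zero]) hhi
  refine ⟨β⁻¹, ⟨inv_pos.2 hβ, ?_⟩, fun α ⟨hα, hαc⟩ => ?_⟩
  · rw [hint _ (inv_pos.2 hβ), inv_inv]
    exact hβc
  · rw [← huniq α⁻¹ ⟨inv_pos.2 hα, (hint α hα).symm.trans hαc⟩, inv_inv]

end
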